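/- Let f : ℝⁿ → ℝ be a convex C² function satisfying Σ_{k=0}^{⌊(n−1)/2⌋} (−1)^k · S_{2k+1}(Hess f(x)) = 0 for all x ∈ ℝⁿ. If lim sup_{‖x‖→∞} |f(x)|/‖x‖² = 0, then f is affine: there exist a ∈ ℝ and b ∈ ℝⁿ such that f(x) = a + ⟨b, x⟩ for all x ∈ ℝⁿ. -/

import Mathlib

open scoped RealInnerProductSpace

/-- `S_k(A)`: the `k`-th elementary symmetric function of the eigenvalues of the
`n × n` real matrix `A`, defined by `det (A + t•I) = ∑_{k=0}^n S_k(A) * t^(n-k)`,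
i.e. `S_k(A)` is the coefficient of `t^(n-k)` in the polynomial `det (A + t•I)`. -/
noncomputable def elemSym (n k : ℕ) (A : Matrix (Fin n) (Fin n) ℝ) : ℝ :=
  ((A.map Polynomial.C +
      (Polynomial.X : Polynomial ℝ) • (1 : Matrix (Fin n) (Fin n) (Polynomial ℝ))).det).coeff
    (n - k)

/-- The Hessian matrix `(∂²f/∂x_i∂x_j (x))_{1 ≤ i,j ≤ n}` of `f` at `x`. -/
noncomputable def hessian (n : ℕ) (f : EuclideanSpace ℝ (Fin n) → ℝ)
    (x : EuclideanSpace ℝ (Fin n)) : Matrix (Fin n) (Fin n) ℝ :=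
  Matrix.of fun i j =>
    iteratedFDeriv ℝ 2 f x ![EuclideanSpace.single i 1, EuclideanSpace.single j 1]

/-- Condition (Q): for each `k` with `1 ≤ k ≤ n`, either `a_k ≡ 0` on `ℝⁿ`, or there
are positive constants `μ₁ ≤ μ₂` with `μ₁ ≤ |a_k x| ≤ μ₂` for all `x`. -/
def CondQ {E : Type*} (n : ℕ) (a : ℕ → E → ℝ) : Prop :=
  ∀ k ∈ Finset.Icc 1 n,
    (∀ x, a k x = 0) ∨
      ∃ μ₁ μ₂ : ℝ, 0 < μ₁ ∧ μ₁ ≤ μ₂ ∧ ∀ x, μ₁ ≤ |a k x| ∧ |a k x| ≤ μ₂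

/-- `lim sup_{‖x‖ → ∞} |f x| / ‖x‖² = 0`: since the quantity `|f x| / ‖x‖²` is
nonnegative, this is equivalent to `|f x| / ‖x‖² → 0` as `‖x‖ → ∞`. -/
def QuadDecay (n : ℕ) (f : EuclideanSpace ℝ (Fin n) → ℝ) : Prop :=
  Filter.Tendsto (fun x => |f x| / ‖x‖ ^ 2) (Filter.comap norm Filter.atTop) (nhds 0)

/-- The imaginary part of a polynomial expression in `I` is the alternating sum of its odd
coefficients. -/
lemma sum_range_mul_im_I_pow (g : ℕ → ℝ) (N : ℕ) :
    ∑ m ∈ Finset.range N, g m * (Complex.I ^ m).im =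
      ∑ k ∈ Finset.range (N / 2), (-1 : ℝ) ^ k * g (2 * k + 1) := by
  induction N with
  | zero => simp
  | succ N ih =>
    have hI (k : ℕ) : Complex.I ^ (2 * k) = (((-1 : ℝ) ^ k : ℝ) : ℂ) := by
      simp [pow_mul]
    rw [Finset.sum_range_succ, ih]
    rcases Nat.even_or_odd' N with ⟨k, rfl | rfl⟩
    · rw [hI, show (2 * k + 1) / 2 = 2 * k / 2 by omega, Complex.ofReal_im]
      simp
    · rw [pow_succ, hI, show (2 * k + 1 + 1) / 2 = (2 * k + 1) / 2 + 1 by omega,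
        Finset.sum_range_succ, show (2 * k + 1) / 2 = k by omega, Complex.im_ofReal_mul]
      simp [mul_comm]

lemma one_add_mul_I_eq_exp_arctan (a : ℝ) :
    1 + a * Complex.I = √(1 + a ^ 2) * Complex.exp (Real.arctan a * Complex.I) := by
  have h : √(1 + a ^ 2) ≠ 0 := by positivity
  rw [Complex.exp_mul_I, ← Complex.ofReal_cos, ← Complex.ofReal_sin, Real.cos_arctan,
    Real.sin_arctan]
  apply Complex.ext <;> simp <;> field_simp

/-- Nonnegative reals `a i` of total sum less than `π` vanish if `∏ (1 + a i * I)` is real. -/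
lemma sum_eq_zero_of_im_prod_one_add_mul_I {ι : Type*} (s : Finset ι) (a : ι → ℝ)
    (h0 : ∀ i ∈ s, 0 ≤ a i) (h1 : ∑ i ∈ s, a i < Real.pi)
    (him : (∏ i ∈ s, (1 + a i * Complex.I)).im = 0) : ∑ i ∈ s, a i = 0 := by
  have hprod : ∏ i ∈ s, (1 + a i * Complex.I) =
      ((∏ i ∈ s, √(1 + a i ^ 2) : ℝ) : ℂ) *
        Complex.exp ((∑ i ∈ s, Real.arctan (a i) : ℝ) * Complex.I) := by
    simp_rw [one_add_mul_I_eq_exp_arctan, Finset.prod_mul_distrib, ← Complex.exp_sum]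
    push_cast
    rw [Finset.sum_mul]
  have hpos : 0 < ∏ i ∈ s, √(1 + a i ^ 2) := Finset.prod_pos fun i _ => by positivity
  rw [hprod, Complex.im_ofReal_mul, Complex.exp_ofReal_mul_I_im, mul_eq_zero,
    or_iff_right hpos.ne'] at him
  have hn : ∀ i ∈ s, 0 ≤ Real.arctan (a i) := fun i hi => Real.arctan_nonneg.2 (h0 i hi)
  have hle : ∑ i ∈ s, Real.arctan (a i) ≤ ∑ i ∈ s, a i :=
    Finset.sum_le_sum fun i hi => by
      simpa [Real.tan_arctan] using Real.le_tan (hn i hi) (Real.arctan_lt_pi_div_two _)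
  have hsum : ∑ i ∈ s, Real.arctan (a i) = 0 :=
    (Real.sin_eq_zero_iff_of_lt_of_lt
      (by linarith [Finset.sum_nonneg hn, Real.pi_pos]) (hle.trans_lt h1)).1 him
  refine Finset.sum_eq_zero fun i hi => ?_
  simpa using (Finset.sum_eq_zero_iff_of_nonneg hn).1 hsum i hi

lemma sum_neg_one_pow_mul_elemSym_eq_im_prod {n : ℕ} (hn : 0 < n)
    {A : Matrix (Fin n) (Fin n) ℝ} (hA : (-A).IsHermitian) :
    ∑ k ∈ Finset.range ((n - 1) / 2 + 1), (-1 : ℝ) ^ k * elemSym n (2 * k + 1) A =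
      (∏ i, (1 + ((-hA.eigenvalues i : ℝ) : ℂ) * Complex.I)).im := by
  have hp : (A.map Polynomial.C + (Polynomial.X : Polynomial ℝ) •
      (1 : Matrix (Fin n) (Fin n) (Polynomial ℝ))).det = (-A).charpoly := by
    rw [Matrix.charpoly, Matrix.charmatrix]
    congr 1
    ext1 i j
    simp [Matrix.smul_one_eq_diagonal, add_comm]
  have heval : Complex.I ^ n * ((-A).charpoly.aeval (-Complex.I)) =
      ∏ i, (1 + ((-hA.eigenvalues i : ℝ) : ℂ) * Complex.I) := by
    have hpow : Complex.I ^ n = ∏ _i : Fin n, Complex.I := by simp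
    rw [hA.charpoly_eq, map_prod, hpow, ← Finset.prod_mul_distrib]
    refine Finset.prod_congr rfl fun i _ => ?_
    simp only [map_sub, Polynomial.aeval_X, Polynomial.aeval_C, Complex.coe_algebraMap,
      Complex.ofReal_neg, RCLike.ofReal_real_eq_id, id]
    linear_combination -Complex.I_mul_I
  have hdeg : (-A).charpoly.natDegree < n + 1 := by
    simp [Matrix.charpoly_natDegree_eq_dim]
  have hexp : Complex.I ^ n * ((-A).charpoly.aeval (-Complex.I)) =
      ∑ m ∈ Finset.range (n + 1), ((elemSym n m A : ℝ) : ℂ) * Complex.I ^ m := by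
    rw [Polynomial.aeval_eq_sum_range' hdeg, ← Finset.sum_range_reflect, Finset.mul_sum]
    refine Finset.sum_congr rfl fun m hm => ?_
    have hm : m ≤ n := Nat.lt_succ_iff.1 (Finset.mem_range.1 hm)
    have hI : Complex.I ^ n * (-Complex.I) ^ (n - m) = Complex.I ^ m := by
      conv_lhs => rw [← Nat.add_sub_cancel' hm]
      rw [Nat.add_sub_cancel_left, pow_add, mul_assoc, ← mul_pow]
      simp
    rw [elemSym, hp, show n + 1 - 1 - m = n - m by omega, Complex.real_smul,
      mul_left_comm, hI]
  rw [← heval, hexp, Complex.im_sum]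
  simp_rw [Complex.im_ofReal_mul]
  rw [sum_range_mul_im_I_pow, show (n + 1) / 2 = (n - 1) / 2 + 1 by omega]

/-- A positive semidefinite solution of the special Lagrangian equation of trace less than `π`
has trace zero. -/
lemma trace_eq_zero_of_sum_elemSym_eq_zero {n : ℕ} (hn : 0 < n)
    {A : Matrix (Fin n) (Fin n) ℝ} (hA : A.PosSemidef) (htr : A.trace < Real.pi)
    (heq : ∑ k ∈ Finset.range ((n - 1) / 2 + 1),
      (-1 : ℝ) ^ k * elemSym n (2 * k + 1) A = 0) : A.trace = 0 := by
  have hB : (-A).IsHermitian := hA.isHermitian.neg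
  have hsum : ∑ i, -hB.eigenvalues i = A.trace := by
    have h := hB.trace_eq_sum_eigenvalues
    rw [Matrix.trace_neg] at h
    simpa [neg_eq_iff_eq_neg] using h.symm
  rw [sum_neg_one_pow_mul_elemSym_eq_im_prod hn hB] at heq
  rw [← hsum] at htr ⊢
  refine sum_eq_zero_of_im_prod_one_add_mul_I _ _ (fun i _ => ?_) htr heq
  rw [hB.eigenvalues_eq, Matrix.neg_mulVec, dotProduct_neg, map_neg, neg_neg]
  exact hA.re_dotProduct_nonneg _

section SecondDerivative

variable {E : Type*} [NormedAddCommGroup E] [NormedSpace ℝ E] {f : E → ℝ}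

lemma ContDiff.deriv_comp_line (hf : ContDiff ℝ 2 f) (x v : E) :
    deriv (fun t : ℝ => f (x + t • v)) = fun t => fderiv ℝ f (x + t • v) v := by
  funext t
  have hl : HasDerivAt (fun t : ℝ => x + t • v) v t := by
    simpa using ((hasDerivAt_id t).smul_const v).const_add x
  exact ((hf.differentiable (by norm_num) _).hasFDerivAt.comp_hasDerivAt t hl).deriv

lemma ContDiff.hasDerivAt_fderiv_line (hf : ContDiff ℝ 2 f) (x v : E) (t : ℝ) :
    HasDerivAt (fun t : ℝ => fderiv ℝ f (x + t • v) v)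
      (fderiv ℝ (fderiv ℝ f) (x + t • v) v v) t := by
  have hl : HasDerivAt (fun t : ℝ => x + t • v) v t := by
    simpa using ((hasDerivAt_id t).smul_const v).const_add x
  have hd : Differentiable ℝ (fderiv ℝ f) :=
    (hf.fderiv_right (m := 1) (by norm_num)).differentiable (by norm_num)
  have h := (hd (x + t • v)).hasFDerivAt.comp_hasDerivAt t hl
  simpa using h.clm_apply (hasDerivAt_const t v)

lemma ConvexOn.fderiv_fderiv_nonneg (hconv : ConvexOn ℝ Set.univ f) (hf : ContDiff ℝ 2 f)
    (x v : E) : 0 ≤ fderiv ℝ (fderiv ℝ f) x v v := by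
  have hc : ConvexOn ℝ Set.univ (fun t : ℝ => f (x + t • v)) := by
    have h := hconv.comp_affineMap (AffineMap.lineMap x (x + v))
    simpa [Function.comp_def, AffineMap.lineMap_apply_module', add_comm] using h
  have hd : ∀ t ∈ (Set.univ : Set ℝ), DifferentiableAt ℝ (fun t : ℝ => f (x + t • v)) t :=
    fun t _ => (hf.differentiable (by norm_num) _).comp t (by fun_prop)
  have hm := hc.monotoneOn_deriv hd
  rw [hf.deriv_comp_line] at hm
  have h := Monotone.deriv_nonneg (x := 0) (monotoneOn_univ.1 hm)
  rw [(hf.hasDerivAt_fderiv_line x v 0).deriv] at h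
  simpa using h

/-- Necessary second order condition at a local maximum. -/
lemma IsLocalMax.deriv_deriv_nonpos {g : ℝ → ℝ} {t : ℝ} (h : IsLocalMax g t)
    (hg : ContinuousAt g t) : deriv (deriv g) t ≤ 0 := by
  by_contra! hpos
  have hmin := isLocalMin_of_deriv_deriv_pos hpos h.deriv_eq_zero hg
  have hconst : g =ᶠ[nhds t] fun _ => g t := by
    filter_upwards [h, hmin] with s h1 h2 using le_antisymm h1 h2
  have h' := hconst.deriv.deriv_eq
  simp at h'
  exact hpos.ne' h'

end SecondDerivative

/-- A function touched from above at `x` by a paraboloid of opening `ε` has second directional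
derivatives at most `2ε`. -/
lemma ContDiff.fderiv_fderiv_le_of_max {E : Type*} [NormedAddCommGroup E] [InnerProductSpace ℝ E]
    {f : E → ℝ} (hf : ContDiff ℝ 2 f) {ε : ℝ} {x : E}
    (hx : ∀ y, f y - ε * ‖y‖ ^ 2 ≤ f x - ε * ‖x‖ ^ 2) (v : E) :
    fderiv ℝ (fderiv ℝ f) x v v ≤ 2 * ε * ‖v‖ ^ 2 := by
  have hq (t : ℝ) : HasDerivAt
      (fun t : ℝ => ε * (‖x‖ ^ 2 + 2 * t * ⟪x, v⟫ + t ^ 2 * ‖v‖ ^ 2))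
      (ε * (2 * ⟪x, v⟫ + 2 * t * ‖v‖ ^ 2)) t := by
    have h := ((((hasDerivAt_id t).const_mul 2).mul_const ⟪x, v⟫).const_add (‖x‖ ^ 2)).add
      (((hasDerivAt_id t).pow 2).mul_const (‖v‖ ^ 2))
    simpa using h.const_mul ε
  have hq' : HasDerivAt (fun t : ℝ => ε * (2 * ⟪x, v⟫ + 2 * t * ‖v‖ ^ 2))
      (ε * (2 * ‖v‖ ^ 2)) 0 := by
    have h := ((((hasDerivAt_id (0 : ℝ)).const_mul 2).mul_const (‖v‖ ^ 2)).const_add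
      (2 * ⟪x, v⟫)).const_mul ε
    simpa using h
  have hnorm (t : ℝ) : ‖x + t • v‖ ^ 2 = ‖x‖ ^ 2 + 2 * t * ⟪x, v⟫ + t ^ 2 * ‖v‖ ^ 2 := by
    rw [norm_add_sq_real, inner_smul_right, norm_smul, mul_pow, Real.norm_eq_abs, sq_abs]
    ring
  set g : ℝ → ℝ := fun t =>
    f (x + t • v) - ε * (‖x‖ ^ 2 + 2 * t * ⟪x, v⟫ + t ^ 2 * ‖v‖ ^ 2) with hg
  have hd (t : ℝ) : DifferentiableAt ℝ (fun t : ℝ => f (x + t • v)) t :=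
    (hf.differentiable (by norm_num) _).comp t (by fun_prop)
  have hmax : IsLocalMax g 0 := by
    refine Filter.Eventually.of_forall fun t => ?_
    have h := hx (x + t • v)
    rw [hnorm] at h
    simpa [hg] using h
  have h1 : deriv g = fun t =>
      fderiv ℝ f (x + t • v) v - ε * (2 * ⟪x, v⟫ + 2 * t * ‖v‖ ^ 2) := by
    funext t
    have h : HasDerivAt g _ t := (hd t).hasDerivAt.sub (hq t)
    rw [h.deriv, hf.deriv_comp_line]
  have h2 := hmax.deriv_deriv_nonpos ((hd 0).sub (hq 0).differentiableAt).continuousAt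
  have h3 := (hf.hasDerivAt_fderiv_line x v 0).sub hq'
  rw [h1] at h2
  replace h2 := h3.deriv.symm.trans_le h2
  simp only [zero_smul, add_zero] at h2
  linarith

lemma QuadDecay.exists_forall_sub_le {n : ℕ} {f : EuclideanSpace ℝ (Fin n) → ℝ}
    (hgrowth : QuadDecay n f) (hf : Continuous f) {ε : ℝ} (hε : 0 < ε) :
    ∃ x, ∀ y, f y - ε * ‖y‖ ^ 2 ≤ f x - ε * ‖x‖ ^ 2 := by
  have hcoc : Filter.comap norm Filter.atTop =
      Filter.cocompact (EuclideanSpace ℝ (Fin n)) := by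
    rw [comap_norm_atTop, Metric.cobounded_eq_cocompact]
  have hnorm := tendsto_norm_cocompact_atTop (E := EuclideanSpace ℝ (Fin n))
  rw [QuadDecay, hcoc] at hgrowth
  have hbot : Filter.Tendsto (fun y => f y - ε * ‖y‖ ^ 2)
      (Filter.cocompact (EuclideanSpace ℝ (Fin n))) Filter.atBot := by
    have h : Filter.Tendsto (fun y : EuclideanSpace ℝ (Fin n) => -(ε / 2 * ‖y‖ ^ 2))
        (Filter.cocompact _) Filter.atBot :=
      Filter.tendsto_neg_atTop_atBot.comp
        (((Filter.tendsto_pow_atTop two_ne_zero).comp hnorm).const_mul_atTop (half_pos hε))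
    refine Filter.tendsto_atBot_mono' _ ?_ h
    filter_upwards [hgrowth.eventually (gt_mem_nhds (half_pos hε)),
      hnorm.eventually (Filter.eventually_gt_atTop 0)] with y hy hy0
    rw [div_lt_iff₀ (by positivity)] at hy
    linarith [le_abs_self (f y)]
  exact (show Continuous fun y => f y - ε * ‖y‖ ^ 2 by fun_prop).exists_forall_ge hbot

section Hessian

variable {n : ℕ} {f : EuclideanSpace ℝ (Fin n) → ℝ}

lemma hessian_apply (x : EuclideanSpace ℝ (Fin n)) (i j : Fin n) :
    hessian n f x i j = fderiv ℝ (fderiv ℝ f) x (EuclideanSpace.single i 1)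
      (EuclideanSpace.single j 1) := by
  simp [hessian, iteratedFDeriv_two_apply]

lemma euclideanSpace_eq_sum_single (v : Fin n → ℝ) :
    WithLp.toLp 2 v = ∑ i, v i • EuclideanSpace.single i (1 : ℝ) := by
  ext j
  simp [Finset.sum_apply, Pi.single_apply]

lemma hessian_posSemidef (hf : ContDiff ℝ 2 f) (hconv : ConvexOn ℝ Set.univ f)
    (x : EuclideanSpace ℝ (Fin n)) : (hessian n f x).PosSemidef := by
  refine Matrix.PosSemidef.of_dotProduct_mulVec_nonneg ?_ fun v => ?_
  · ext i j
    rw [Matrix.conjTranspose_apply, hessian_apply, hessian_apply, star_trivial]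
    exact (hf.contDiffAt.isSymmSndFDerivAt (by simp)) _ _
  · have h := hconv.fderiv_fderiv_nonneg hf x (WithLp.toLp 2 v)
    rw [euclideanSpace_eq_sum_single] at h
    simp only [map_sum, map_smul, sum_apply, smul_apply, Finset.smul_sum] at h
    rw [Finset.sum_comm] at h
    simpa [Matrix.mulVec, dotProduct, hessian_apply, Finset.mul_sum, mul_comm,
      mul_left_comm] using h

lemma continuous_trace_hessian (hf : ContDiff ℝ 2 f) :
    Continuous fun x => (hessian n f x).trace := by
  have h : Continuous (fderiv ℝ (fderiv ℝ f)) :=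
    (hf.fderiv_right (m := 1) (by norm_num)).continuous_fderiv (by norm_num)
  simp only [Matrix.trace, Matrix.diag_apply, hessian_apply]
  fun_prop

lemma exists_affine_of_hessian_eq_zero (hf : ContDiff ℝ 2 f) (h : ∀ x, hessian n f x = 0) :
    ∃ (c : ℝ) (b : EuclideanSpace ℝ (Fin n)), ∀ x, f x = c + ⟪b, x⟫ := by
  have hd : Differentiable ℝ (fderiv ℝ f) :=
    (hf.fderiv_right (m := 1) (by norm_num)).differentiable (by norm_num)
  have h2 : ∀ x, fderiv ℝ (fderiv ℝ f) x = 0 := by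
    intro x
    ext v w
    have hv := euclideanSpace_eq_sum_single v.ofLp
    have hw := euclideanSpace_eq_sum_single w.ofLp
    rw [WithLp.toLp_ofLp] at hv hw
    rw [hv, hw]
    simp [← hessian_apply, h]
  have hL (x) : fderiv ℝ f x = fderiv ℝ f 0 := is_const_of_fderiv_eq_zero hd h2 x 0
  have hf1 : Differentiable ℝ f := hf.differentiable (by norm_num)
  have hconst (x) := is_const_of_fderiv_eq_zero (𝕜 := ℝ)
    (f := fun x => f x - fderiv ℝ f 0 x) (by fun_prop)
    (fun y => by
      rw [fderiv_fun_sub (hf1 y) (by fun_prop), ContinuousLinearMap.fderiv, hL, sub_self]) x 0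
  refine ⟨f 0, (InnerProductSpace.toDual ℝ _).symm (fderiv ℝ f 0), fun x => ?_⟩
  have hx := hconst x
  simp only [map_zero, sub_zero] at hx
  rw [InnerProductSpace.toDual_symm_apply]
  linarith

end Hessian

/-- Special case (special Lagrangian equation): a convex `C²` solution of
`∑_{k=0}^{⌊(n−1)/2⌋} (−1)^k S_{2k+1}(Hess f) = 0` on `ℝⁿ` with
`lim sup_{‖x‖→∞} |f(x)|/‖x‖² = 0` is affine. -/
theorem stmt6 (n : ℕ) (hn : 0 < n)
    (f : EuclideanSpace ℝ (Fin n) → ℝ)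
    (hf : ContDiff ℝ 2 f)
    (hconv : ConvexOn ℝ Set.univ f)
    (heq : ∀ x, ∑ k ∈ Finset.range ((n - 1) / 2 + 1),
      (-1 : ℝ) ^ k * elemSym n (2 * k + 1) (hessian n f x) = 0)
    (hgrowth : QuadDecay n f) :
    ∃ (c : ℝ) (b : EuclideanSpace ℝ (Fin n)), ∀ x, f x = c + ⟪b, x⟫ := by
  have hpsd := hessian_posSemidef hf hconv
  have hgap (x) (hx : (hessian n f x).trace ≤ 1) : (hessian n f x).trace = 0 :=
    trace_eq_zero_of_sum_elemSym_eq_zero hn (hpsd x) (by linarith [Real.pi_gt_three]) (heq x)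
  obtain ⟨x₀, hx₀⟩ := hgrowth.exists_forall_sub_le hf.continuous
    (ε := 1 / (2 * n)) (by positivity)
  have htr₀ : (hessian n f x₀).trace ≤ 1 := by
    have h (i : Fin n) : hessian n f x₀ i i ≤ 1 / n := by
      have h := hf.fderiv_fderiv_le_of_max hx₀ (EuclideanSpace.single i 1)
      rw [← hessian_apply] at h
      refine h.trans_eq ?_
      simp
      field_simp
    refine (Finset.sum_le_sum fun i _ => h i).trans_eq ?_
    simp
    field_simp
  refine exists_affine_of_hessian_eq_zero hf fun x => (hpsd x).trace_eq_zero_iff.1 ?_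
  by_contra hx
  have hx1 : 1 < (hessian n f x).trace := lt_of_not_ge fun h => hx (hgap x h)
  obtain ⟨y, hy⟩ := mem_range_of_exists_le_of_exists_ge (c := (1 / 2 : ℝ))
    (continuous_trace_hessian hf) ⟨x₀, by rw [hgap x₀ htr₀]; norm_num⟩ ⟨x, by linarith⟩
  have hy : (hessian n f y).trace = 1 / 2 := hy
  linarith [hgap y (by linarith)]
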